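/- arXiv:2512.14581 — 4 statements merged into one kernel-verified Lean document; each statement's English description precedes it below -/
import Mathlib

section
/- Let f ∈ C^∞(ℝ) be such that for every n ∈ ℕ there exists R_n > 0 such that f^(n)(x) > 0 for all x < −R_n and (−1)^n f^(n)(x) > 0 for all x > R_n. Then for every n ≥ 1 and all real numbers x_1, …, x_n satisfying max_{k ≤ n} R_k < |x_1| ≤ ⋯ ≤ |x_n|, the divided difference f'[x_1, …, x_n] is nonzero and sgn f'[x_1, …, x_n] = (−1)^n sgn(x_1 ⋯ x_n); equivalently, the weighted divided difference f'{x_1, …, x_n} is strictly positive. -/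
open MeasureTheory

/-- Divided difference of order `n-1` of `f` at the `n` points `x`, defined via the
integral formula over the simplex (and set to `0` for the empty tuple). -/
noncomputable def divDiff (f : ℝ → ℝ) : {n : ℕ} → (Fin n → ℝ) → ℝ
  | 0, _ => 0
  | m + 1, x =>
    ∫ t in {t : Fin m → ℝ | Monotone t ∧ ∀ j, t j ∈ Set.Icc (0 : ℝ) 1},
      iteratedDeriv m f (x (Fin.last m) + ∑ j : Fin m, (x j.castSucc - x j.succ) * t j)

/-- Weighted divided difference `f'{x_1,…,x_n} = (−1)^n x_1⋯x_n f'[x_1,…,x_n]`. -/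
noncomputable def wDivDiff (f : ℝ → ℝ) {n : ℕ} (x : Fin n → ℝ) : ℝ :=
  (-1 : ℝ) ^ n * (∏ j, x j) * divDiff (deriv f) x

/-- The nodes `0, t_0, …, t_{m-1}, 1, 1, …` of a tuple, extended to all of `ℕ`. -/
noncomputable def extendNodes {m : ℕ} (t : Fin m → ℝ) : ℕ → ℝ
  | 0 => 0
  | i + 1 => if h : i < m then t ⟨i, h⟩ else 1

/-- The set of monotone tuples with values in the unit interval. -/
def orderedSimplex (m : ℕ) : Set (Fin m → ℝ) :=
  {t | Monotone t ∧ ∀ j, t j ∈ Set.Icc (0 : ℝ) 1}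

/-- The point at which the integrand of the divided difference is evaluated. -/
def nodeCombination {m : ℕ} (x : Fin (m + 1) → ℝ) (t : Fin m → ℝ) : ℝ :=
  x (Fin.last m) + ∑ j : Fin m, (x j.castSucc - x j.succ) * t j

lemma divDiff_succ (f : ℝ → ℝ) {m : ℕ} (x : Fin (m + 1) → ℝ) :
    divDiff f x = ∫ t in orderedSimplex m, iteratedDeriv m f (nodeCombination x t) := rfl

@[simp] lemma extendNodes_zero {m : ℕ} (t : Fin m → ℝ) : extendNodes t 0 = 0 := rfl

@[simp] lemma extendNodes_val_succ {m : ℕ} (t : Fin m → ℝ) (i : Fin m) :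
    extendNodes t (i + 1) = t i := by
  simp [extendNodes]

lemma extendNodes_of_lt {m : ℕ} (t : Fin m → ℝ) {i : ℕ} (h : m < i) : extendNodes t i = 1 := by
  obtain _ | i := i
  · omega
  · simp only [extendNodes]
    rw [dif_neg (by omega)]

lemma mem_orderedSimplex_iff {m : ℕ} {t : Fin m → ℝ} :
    t ∈ orderedSimplex m ↔ Monotone (extendNodes t) := by
  constructor
  · rintro ⟨hm, hI⟩
    refine monotone_nat_of_le_succ fun i => ?_
    obtain _ | i := i
    · simp only [extendNodes]
      split_ifs
      exacts [(hI _).1, zero_le_one]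
    · simp only [extendNodes]
      split_ifs
      · exact hm (by simp)
      · exact (hI _).2
      · omega
      · exact le_rfl
  · intro h
    refine ⟨fun i j hij => ?_, fun j => ⟨?_, ?_⟩⟩
    · rw [← extendNodes_val_succ t i, ← extendNodes_val_succ t j]
      exact h (by simpa using hij)
    · rw [← extendNodes_val_succ t j, ← extendNodes_zero t]
      exact h (Nat.zero_le _)
    · rw [← extendNodes_val_succ t j, ← extendNodes_of_lt t (Nat.lt_succ_self m)]
      exact h (by omega)

lemma nodeCombination_eq_sum {m : ℕ} (x : Fin (m + 1) → ℝ) (t : Fin m → ℝ) :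
    nodeCombination x t =
      ∑ i : Fin (m + 1), (extendNodes t (i + 1) - extendNodes t i) * x i := by
  simp only [sub_mul, Finset.sum_sub_distrib]
  rw [Fin.sum_univ_castSucc, Fin.sum_univ_succ (fun i : Fin (m + 1) => extendNodes t i * x i)]
  simp only [Fin.val_castSucc, Fin.val_last, Fin.val_zero, Fin.val_succ, extendNodes_zero,
    extendNodes_val_succ, extendNodes_of_lt t (Nat.lt_succ_self m), nodeCombination, sub_mul,
    Finset.sum_sub_distrib, mul_comm (t _)]
  ring

lemma nodeCombination_mem {m : ℕ} {x : Fin (m + 1) → ℝ} {t : Fin m → ℝ} {s : Set ℝ}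
    (hs : Convex ℝ s) (ht : t ∈ orderedSimplex m) (hx : ∀ i, x i ∈ s) :
    nodeCombination x t ∈ s := by
  rw [nodeCombination_eq_sum]
  refine hs.sum_mem (fun i _ => ?_) ?_ fun i _ => hx i
  · exact sub_nonneg.2 (mem_orderedSimplex_iff.1 ht (Nat.le_succ _))
  · rw [Fin.sum_univ_eq_sum_range (fun i => extendNodes t (i + 1) - extendNodes t i),
      Finset.sum_range_sub, extendNodes_of_lt t (Nat.lt_succ_self m), extendNodes_zero, sub_zero]

lemma continuous_nodeCombination {m : ℕ} (x : Fin (m + 1) → ℝ) :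
    Continuous (nodeCombination x) := by
  unfold nodeCombination
  fun_prop

lemma isCompact_orderedSimplex (m : ℕ) : IsCompact (orderedSimplex m) := by
  have h : orderedSimplex m =
      {t | Monotone t} ∩ Set.univ.pi fun _ : Fin m => Set.Icc (0 : ℝ) 1 := by
    ext t
    simp only [orderedSimplex, Set.mem_ofPred_eq, Set.mem_inter_iff, Set.mem_univ_pi]
  rw [h, Set.inter_comm]
  exact (isCompact_univ_pi fun _ => isCompact_Icc).inter_right isClosed_monotone

lemma volume_orderedSimplex_pos (m : ℕ) : 0 < volume (orderedSimplex m) := by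
  let B : Set (Fin m → ℝ) :=
    Set.univ.pi fun j : Fin m => Set.Ioo ((j : ℝ) / m) (((j : ℝ) + 1) / m)
  have hB : IsOpen B := isOpen_set_pi Set.finite_univ fun _ _ => isOpen_Ioo
  have hne : B.Nonempty := by
    refine Set.univ_pi_nonempty_iff.2 fun j => Set.nonempty_Ioo.2 ?_
    have : (0 : ℝ) < m := by exact_mod_cast j.pos
    gcongr
    linarith
  refine (hB.measure_pos volume hne).trans_le (measure_mono fun t ht => ?_)
  have ht' : ∀ j : Fin m, (j : ℝ) / m < t j ∧ t j < ((j : ℝ) + 1) / m := fun j =>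
    ht j (Set.mem_univ j)
  refine ⟨fun i j hij => ?_, fun j => ⟨?_, ?_⟩⟩
  · obtain rfl | hlt := hij.eq_or_lt
    · exact le_rfl
    · have h : ((i : ℝ) + 1) / m ≤ (j : ℝ) / m := by
        gcongr
        exact_mod_cast hlt
      linarith [(ht' i).2, (ht' j).1]
  · exact le_trans (by positivity) (ht' j).1.le
  · have hm : (0 : ℝ) < m := by exact_mod_cast j.pos
    refine (ht' j).2.le.trans ((div_le_one hm).2 ?_)
    exact_mod_cast j.2

lemma setIntegral_orderedSimplex_pos {m : ℕ} {φ : (Fin m → ℝ) → ℝ} (hφ : Continuous φ)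
    (hpos : ∀ t ∈ orderedSimplex m, 0 < φ t) : 0 < ∫ t in orderedSimplex m, φ t := by
  have hK := isCompact_orderedSimplex m
  rw [setIntegral_pos_iff_support_of_nonneg_ae
    ((ae_restrict_iff' hK.measurableSet).2 (.of_forall fun t ht => (hpos t ht).le))
    (hφ.continuousOn.integrableOn_compact hK)]
  have hsub : orderedSimplex m ⊆ Function.support φ := fun t ht => (hpos t ht).ne'
  rw [Set.inter_eq_right.2 hsub]
  exact volume_orderedSimplex_pos m

lemma extendNodes_insertNth {m : ℕ} (j : Fin (m + 1)) (s : ℝ) (t : Fin m → ℝ) (l : ℕ) :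
    extendNodes (j.insertNth s t : Fin (m + 1) → ℝ) l =
      if l ≤ j then extendNodes t l else if l = j + 1 then s else extendNodes t (l - 1) := by
  obtain _ | l := l
  · simp
  by_cases hl : l < m + 1
  swap
  · rw [extendNodes_of_lt _ (by omega), if_neg (by omega), if_neg (by omega),
      extendNodes_of_lt _ (by omega)]
  obtain ⟨i, rfl⟩ : ∃ i : Fin (m + 1), (i : ℕ) = l := ⟨⟨l, hl⟩, rfl⟩
  rw [extendNodes_val_succ]
  obtain rfl | ⟨i, rfl⟩ := j.eq_self_or_eq_succAbove i
  · simp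
  rw [Fin.insertNth_apply_succAbove]
  obtain h | h := lt_or_ge i.castSucc j
  · rw [Fin.succAbove_of_castSucc_lt _ _ h, Fin.val_castSucc, if_pos (show (i : ℕ) + 1 ≤ j from h),
      extendNodes_val_succ]
  · have h' : (j : ℕ) ≤ i := h
    rw [Fin.succAbove_of_le_castSucc _ _ h, Fin.val_succ, if_neg (by omega), if_neg (by omega),
      Nat.add_sub_cancel, extendNodes_val_succ]

lemma insertNth_mem_orderedSimplex_iff {m : ℕ} (j : Fin (m + 1)) (s : ℝ) (t : Fin m → ℝ) :
    (j.insertNth s t : Fin (m + 1) → ℝ) ∈ orderedSimplex (m + 1) ↔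
      t ∈ orderedSimplex m ∧ s ∈ Set.Icc (extendNodes t j) (extendNodes t (j + 1)) := by
  simp only [mem_orderedSimplex_iff]
  constructor
  · intro h
    have h1 := h (Nat.le_succ (j : ℕ))
    have h2 := h (Nat.le_succ (j + 1 : ℕ))
    simp only [extendNodes_insertNth] at h1 h2
    simp at h1 h2
    refine ⟨monotone_nat_of_le_succ fun l => ?_, h1, h2⟩
    obtain hl | rfl | hl := lt_trichotomy l j
    · have h3 := h (Nat.le_succ l)
      simp only [extendNodes_insertNth] at h3
      rwa [if_pos (by omega), if_pos (by omega)] at h3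
    · exact h1.trans h2
    · have h3 := h (Nat.le_succ (l + 1))
      simp only [extendNodes_insertNth] at h3
      rwa [if_neg (by omega), if_neg (by omega), if_neg (by omega), if_neg (by omega)] at h3
  · rintro ⟨h, h1, h2⟩
    refine monotone_nat_of_le_succ fun l => ?_
    simp only [extendNodes_insertNth]
    split_ifs
    any_goals omega
    · exact h (by omega)
    · obtain rfl : l = j := by omega
      exact h1
    · subst l
      simpa using h2
    · exact h (by omega)

lemma nodeCombination_insertNth {m : ℕ} (x : Fin (m + 2) → ℝ) (j : Fin (m + 1)) (s : ℝ)
    (t : Fin m → ℝ) :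
    nodeCombination x (j.insertNth s t : Fin (m + 1) → ℝ) =
      nodeCombination x (j.insertNth 0 t : Fin (m + 1) → ℝ) +
        (x j.castSucc - x j.succ) * s := by
  simp only [nodeCombination, Fin.sum_univ_succAbove _ j, Fin.insertNth_apply_same,
    Fin.insertNth_apply_succAbove]
  ring

lemma nodeCombination_insertNth_upper {m : ℕ} (x : Fin (m + 2) → ℝ) (j : Fin (m + 1))
    (t : Fin m → ℝ) :
    nodeCombination x (j.insertNth (extendNodes t (j + 1)) t : Fin (m + 1) → ℝ) =
      nodeCombination (x ∘ j.succ.succAbove) t := by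
  simp only [nodeCombination_eq_sum, Fin.sum_univ_succAbove _ j.succ, extendNodes_insertNth]
  simp only [Fin.val_succ, Function.comp]
  rw [if_neg (by omega), if_neg (by omega), if_neg (by omega)]
  simp only [Nat.add_sub_cancel, if_true, sub_self, zero_mul, zero_add]
  refine Finset.sum_congr rfl fun i _ => ?_
  congr 1
  obtain h | h := lt_or_ge i.castSucc j.succ
  · have h' : (i : ℕ) < j + 1 := h
    rw [Fin.succAbove_of_castSucc_lt _ _ h, Fin.val_castSucc]
    split_ifs
    any_goals omega
    · rfl
    · obtain h0 : (i : ℕ) = j := by omega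
      rw [h0]
  · have h' : (j + 1 : ℕ) ≤ i := h
    rw [Fin.succAbove_of_le_castSucc _ _ h, Fin.val_succ]
    split_ifs
    any_goals omega
    simp

lemma nodeCombination_insertNth_lower {m : ℕ} (x : Fin (m + 2) → ℝ) (j : Fin (m + 1))
    (t : Fin m → ℝ) :
    nodeCombination x (j.insertNth (extendNodes t j) t : Fin (m + 1) → ℝ) =
      nodeCombination (x ∘ j.castSucc.succAbove) t := by
  simp only [nodeCombination_eq_sum, Fin.sum_univ_succAbove _ j.castSucc, extendNodes_insertNth]
  simp only [Fin.val_castSucc, Function.comp]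
  rw [if_neg (by omega), if_pos le_rfl]
  simp only [if_true, sub_self, zero_mul, zero_add]
  refine Finset.sum_congr rfl fun i _ => ?_
  congr 1
  obtain h | h := lt_or_ge i.castSucc j.castSucc
  · have h' : (i : ℕ) < j := h
    rw [Fin.succAbove_of_castSucc_lt _ _ h, Fin.val_castSucc]
    split_ifs
    any_goals omega
    rfl
  · have h' : (j : ℕ) ≤ i := h
    rw [Fin.succAbove_of_le_castSucc _ _ h, Fin.val_succ]
    split_ifs
    any_goals omega
    · obtain h0 : (i : ℕ) = j := by omega
      simp [h0]
    · simp

lemma setIntegral_orderedSimplex_succ {m : ℕ} (j : Fin (m + 1)) {φ : (Fin (m + 1) → ℝ) → ℝ}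
    (hφ : Continuous φ) :
    ∫ t in orderedSimplex (m + 1), φ t =
      ∫ t in orderedSimplex m,
        ∫ s in extendNodes t j..extendNodes t (j + 1), φ (j.insertNth s t) := by
  have hK := isCompact_orderedSimplex (m + 1)
  have hint : Integrable ((orderedSimplex (m + 1)).indicator φ) :=
    (hφ.continuousOn.integrableOn_compact hK).integrable_indicator hK.measurableSet
  have he := (volume_preserving_piFinSuccAbove (fun _ : Fin (m + 1) => ℝ) j).symm
  rw [← integral_indicator hK.measurableSet,
    ← he.integral_comp (MeasurableEquiv.measurableEmbedding _)]
  have hint' : Integrable fun p : ℝ × (Fin m → ℝ) => (orderedSimplex (m + 1)).indicator φ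
      ((MeasurableEquiv.piFinSuccAbove (fun _ : Fin (m + 1) => ℝ) j).symm p) :=
    (he.integrable_comp_emb (MeasurableEquiv.measurableEmbedding _)).2 hint
  rw [Measure.volume_eq_prod] at hint' ⊢
  rw [integral_prod_symm _ hint', ← integral_indicator (isCompact_orderedSimplex m).measurableSet]
  refine integral_congr_ae (.of_forall fun t => ?_)
  have hsymm : ∀ s : ℝ,
      (MeasurableEquiv.piFinSuccAbove (fun _ : Fin (m + 1) => ℝ) j).symm (s, t) =
        (j.insertNth s t : Fin (m + 1) → ℝ) := fun s => rfl
  simp only [hsymm]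
  by_cases ht : t ∈ orderedSimplex m
  · rw [Set.indicator_of_mem ht, intervalIntegral.integral_of_le
      (mem_orderedSimplex_iff.1 ht (Nat.le_succ _)), ← integral_Icc_eq_integral_Ioc,
      ← integral_indicator measurableSet_Icc]
    congr 1
    ext s
    have hmem := insertNth_mem_orderedSimplex_iff j s t
    by_cases hs : s ∈ Set.Icc (extendNodes t j) (extendNodes t (j + 1))
    · rw [Set.indicator_of_mem (hmem.2 ⟨ht, hs⟩), Set.indicator_of_mem hs]
    · rw [Set.indicator_of_notMem (fun h => hs (hmem.1 h).2), Set.indicator_of_notMem hs]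
  · simp [insertNth_mem_orderedSimplex_iff, ht]

/-- The recursion for divided differences obtained by deleting one of two adjacent points. -/
lemma sub_mul_divDiff {g : ℝ → ℝ} (hg : ContDiff ℝ (⊤ : ℕ∞) g) {m : ℕ} (x : Fin (m + 2) → ℝ)
    (j : Fin (m + 1)) :
    (x j.castSucc - x j.succ) * divDiff g x =
      divDiff g (x ∘ j.succ.succAbove) - divDiff g (x ∘ j.castSucc.succAbove) := by
  have hcont : ∀ k, Continuous (iteratedDeriv k g) := fun k =>
    hg.continuous_iteratedDeriv k (by exact_mod_cast le_top)
  have hderiv : ∀ y, HasDerivAt (iteratedDeriv m g) (iteratedDeriv (m + 1) g y) y := fun y => by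
    rw [iteratedDeriv_succ]
    exact (hg.differentiable_iteratedDeriv m
      (by exact_mod_cast ENat.natCast_lt_top m) y).hasDerivAt
  have hint : ∀ y : Fin (m + 1) → ℝ, IntegrableOn
      (fun t => iteratedDeriv m g (nodeCombination y t)) (orderedSimplex m) := fun y =>
    ((hcont m).comp (continuous_nodeCombination y)).continuousOn.integrableOn_compact
      (isCompact_orderedSimplex m)
  simp only [divDiff_succ]
  rw [setIntegral_orderedSimplex_succ j
      (φ := fun t => iteratedDeriv (m + 1) g (nodeCombination x t))
      ((hcont (m + 1)).comp (continuous_nodeCombination x)),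
    ← integral_const_mul, ← integral_sub (hint _) (hint _)]
  refine integral_congr_ae (.of_forall fun t => ?_)
  simp only
  rw [← nodeCombination_insertNth_upper, ← nodeCombination_insertNth_lower,
    ← intervalIntegral.integral_const_mul]
  obtain ⟨c, hc⟩ : ∃ c, ∀ s : ℝ, nodeCombination x (j.insertNth s t : Fin (m + 1) → ℝ) =
      c + (x j.castSucc - x j.succ) * s := ⟨_, fun s => nodeCombination_insertNth x j s t⟩
  simp only [hc]
  have hd : ∀ s : ℝ, HasDerivAt
      (fun s => iteratedDeriv m g (c + (x j.castSucc - x j.succ) * s))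
      ((x j.castSucc - x j.succ) *
        iteratedDeriv (m + 1) g (c + (x j.castSucc - x j.succ) * s)) s := by
    intro s
    have := (hderiv (c + (x j.castSucc - x j.succ) * s)).comp s
      (((hasDerivAt_id s).const_mul (x j.castSucc - x j.succ)).const_add c)
    rw [mul_one, mul_comm] at this
    exact this
  refine intervalIntegral.integral_eq_sub_of_hasDerivAt (fun s _ => hd s) ?_
  refine Continuous.intervalIntegrable ?_ _ _
  exact continuous_const.mul ((hcont (m + 1)).comp (by fun_prop))

lemma wDivDiff_pos_of_forall_lt_abs {f : ℝ → ℝ} (hf : ContDiff ℝ (⊤ : ℕ∞) f) {R : ℕ → ℝ}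
    (hRpos : ∀ n : ℕ, 0 < R n)
    (hneg : ∀ n : ℕ, ∀ x : ℝ, x < -R n → 0 < iteratedDeriv n f x)
    (hpos : ∀ n : ℕ, ∀ x : ℝ, R n < x → 0 < (-1 : ℝ) ^ n * iteratedDeriv n f x)
    (m : ℕ) (x : Fin (m + 1) → ℝ) (hx : ∀ k ≤ m + 1, ∀ i, R k < |x i|) :
    0 < wDivDiff f x := by
  induction m using Nat.strong_induction_on with | _ m ih
  have hf' : ContDiff ℝ (⊤ : ℕ∞) (deriv f) := by
    have h : ContDiff ℝ ((⊤ : ℕ∞) + 1) f := by simpa using hf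
    exact (contDiff_succ_iff_deriv.1 h).2.2
  have hcont : ∀ n, Continuous (iteratedDeriv n f) := fun n =>
    hf.continuous_iteratedDeriv n (by exact_mod_cast le_top)
  have hx0 : ∀ i, x i ≠ 0 := fun i => abs_pos.1 ((hRpos 0).trans (hx 0 (Nat.zero_le _) i))
  have hdiv : divDiff (deriv f) x =
      ∫ t in orderedSimplex m, iteratedDeriv (m + 1) f (nodeCombination x t) := by
    rw [divDiff_succ, ← iteratedDeriv_succ']
  by_cases hP : ∀ i, 0 < x i
  · have hint : 0 < ∫ t in orderedSimplex m,
        (-1 : ℝ) ^ (m + 1) * iteratedDeriv (m + 1) f (nodeCombination x t) := by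
      refine setIntegral_orderedSimplex_pos (continuous_const.mul
        ((hcont _).comp (continuous_nodeCombination x))) fun t ht => hpos _ _ ?_
      refine nodeCombination_mem (convex_Ioi (R (m + 1))) ht fun i => ?_
      have := hx _ le_rfl i
      rwa [abs_of_pos (hP i)] at this
    rw [integral_const_mul, ← hdiv] at hint
    have := mul_pos (Finset.prod_pos fun i (_ : i ∈ Finset.univ) => hP i) hint
    rw [wDivDiff]
    linarith
  by_cases hN : ∀ i, x i < 0
  · have hint : 0 < divDiff (deriv f) x := by
      rw [hdiv]
      refine setIntegral_orderedSimplex_pos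
        ((hcont _).comp (continuous_nodeCombination x)) fun t ht => hneg _ _ ?_
      refine nodeCombination_mem (convex_Iio (-R (m + 1))) ht fun i => ?_
      have := hx _ le_rfl i
      rw [abs_of_neg (hN i)] at this
      exact lt_neg_of_lt_neg this
    have hprod : (-1 : ℝ) ^ (m + 1) * ∏ i, x i = ∏ i, -x i := by
      rw [Finset.prod_neg]
      simp
    rw [wDivDiff, hprod]
    exact mul_pos (Finset.prod_pos fun i _ => neg_pos.2 (hN i)) hint
  obtain ⟨j, hj⟩ : ∃ j : Fin m, x j.castSucc * x j.succ < 0 := by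
    by_contra! h
    have hstep : ∀ j : Fin m, 0 < x j.castSucc * x j.succ := fun j =>
      (h j).lt_of_ne (mul_ne_zero (hx0 _) (hx0 _)).symm
    obtain h0 | h0 := lt_or_gt_of_ne (hx0 0)
    · exact hN fun i => Fin.induction h0 (fun j hj => (neg_iff_neg_of_mul_pos (hstep j)).1 hj) i
    · exact hP fun i => Fin.induction h0 (fun j hj => (pos_iff_pos_of_mul_pos (hstep j)).1 hj) i
  obtain _ | m := m
  · exact j.elim0
  replace ih := ih m (Nat.lt_succ_self m)
  have hA := ih (x ∘ j.succ.succAbove) fun k hk i => hx k (by omega) _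
  have hB := ih (x ∘ j.castSucc.succAbove) fun k hk i => hx k (by omega) _
  have hrec := sub_mul_divDiff hf' x j
  have hpA := Fin.prod_univ_succAbove x j.succ
  have hpB := Fin.prod_univ_succAbove x j.castSucc
  have key : (x j.castSucc - x j.succ) * wDivDiff f x =
      x j.castSucc * wDivDiff f (x ∘ j.castSucc.succAbove) -
        x j.succ * wDivDiff f (x ∘ j.succ.succAbove) := by
    simp only [wDivDiff, Function.comp_apply] at hrec ⊢
    calc _ = (-1 : ℝ) ^ (m + 1 + 1) * (∏ i, x i) *
          ((x j.castSucc - x j.succ) * divDiff (deriv f) x) := by ring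
      _ = (-1 : ℝ) ^ (m + 1 + 1) * ((∏ i, x i) * divDiff (deriv f) (x ∘ j.succ.succAbove) -
          (∏ i, x i) * divDiff (deriv f) (x ∘ j.castSucc.succAbove)) := by
        rw [hrec]; ring
      _ = _ := by
        nth_rewrite 1 [hpA]
        rw [hpB]
        ring
  obtain ⟨h1, h2⟩ | ⟨h1, h2⟩ := mul_neg_iff.1 hj
  · refine pos_of_mul_pos_right (b := wDivDiff f x) (a := x j.castSucc - x j.succ) ?_ (by linarith)
    rw [key]
    linarith [mul_pos h1 hB, mul_neg_of_neg_of_pos h2 hA]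
  · refine pos_of_mul_neg_right (b := wDivDiff f x) (a := x j.castSucc - x j.succ) ?_ (by linarith)
    rw [key]
    linarith [mul_pos h2 hA, mul_neg_of_neg_of_pos h1 hB]

/-- signs of divided differences, generalized Hunter positivity:
if all derivatives of `f` are positive far to the left and `(-1)^n f^(n)` is positive
far to the right, then for points `max_{k ≤ n} R_k < |x_1| ≤ ⋯ ≤ |x_n|` the divided
difference `f'[x_1,…,x_n]` is nonzero, its sign is `(−1)^n sgn(x_1⋯x_n)`, and
equivalently the weighted divided difference `f'{x_1,…,x_n}` is strictly positive. -/
theorem statement0 (f : ℝ → ℝ) (hf : ContDiff ℝ (⊤ : ℕ∞) f) (R : ℕ → ℝ)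
    (hRpos : ∀ n : ℕ, 0 < R n)
    (hneg : ∀ n : ℕ, ∀ x : ℝ, x < -R n → 0 < iteratedDeriv n f x)
    (hpos : ∀ n : ℕ, ∀ x : ℝ, R n < x → 0 < (-1 : ℝ) ^ n * iteratedDeriv n f x)
    (n : ℕ) (hn : 1 ≤ n) (x : Fin n → ℝ)
    (hsmall : ∀ k : ℕ, k ≤ n → R k < |x ⟨0, hn⟩|)
    (hmono : Monotone fun j => |x j|) :
    divDiff (deriv f) x ≠ 0 ∧
      Real.sign (divDiff (deriv f) x) = (-1 : ℝ) ^ n * Real.sign (∏ j, x j) ∧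
      0 < wDivDiff f x := by
  obtain ⟨m, rfl⟩ : ∃ m, n = m + 1 := ⟨n - 1, by omega⟩
  have hW : 0 < wDivDiff f x :=
    wDivDiff_pos_of_forall_lt_abs hf hRpos hneg hpos m x fun k hk i =>
      (hsmall k hk).trans_le (hmono (Fin.zero_le i))
  have hD : divDiff (deriv f) x ≠ 0 := fun h => by simp [wDivDiff, h] at hW
  refine ⟨hD, ?_, hW⟩
  rw [wDivDiff] at hW
  obtain he | he := neg_one_pow_eq_or ℝ (m + 1) <;> rw [he] at hW ⊢ <;>
    obtain hd | hd := lt_or_gt_of_ne hD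
  · have : ∏ i, x i < 0 := by nlinarith
    rw [Real.sign_of_neg hd, Real.sign_of_neg this, one_mul]
  · have : 0 < ∏ i, x i := by nlinarith
    rw [Real.sign_of_pos hd, Real.sign_of_pos this, one_mul]
  · have : 0 < ∏ i, x i := by nlinarith
    rw [Real.sign_of_neg hd, Real.sign_of_pos this, mul_one]
  · have : ∏ i, x i < 0 := by nlinarith
    rw [Real.sign_of_pos hd, Real.sign_of_neg this]
    norm_num
end

section
/- Let f ∈ C^∞(ℝ) be such that f' is of order at most −1, let n ≥ 2, and define g_n : ℝ → ℝ by g_n(x) := −x^{n−2} f'(1/x) for x ≠ 0 and g_n(0) := 0. Then g_n is of class C^{n−2} on ℝ and of class C^∞ on ℝ∖{0}, and for all x ≠ 0 one has g_n^{(n−1)}(x) = (−1)^n x^{−n} f^{(n)}(1/x). -/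
/-- `f` is of order at most `r`: for every `k` there are `R, c₂ > 0` with
`|f^(k)(x)| ≤ c₂ |x|^(r-k)` for all `|x| > R`. -/
def OrderAtMost (f : ℝ → ℝ) (r : ℝ) : Prop :=
  ∀ k : ℕ, ∃ R c₂ : ℝ, 0 < R ∧ 0 < c₂ ∧
    ∀ x : ℝ, R < |x| → |iteratedDeriv k f x| ≤ c₂ * |x| ^ (r - (k : ℝ))

/-- The function `g_n(x) = −x^(n−2) f'(1/x)` for `x ≠ 0`, with `g_n(0) = 0`. -/
noncomputable def gfun (f : ℝ → ℝ) (n : ℕ) (x : ℝ) : ℝ :=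
  if x = 0 then 0 else -x ^ (n - 2) * deriv f (1 / x)

open Filter Topology Asymptotics in
theorem OrderAtMost.isBigO_comp_inv {φ : ℝ → ℝ} {r : ℝ} (h : OrderAtMost φ r) :
    (fun x : ℝ => φ x⁻¹) =O[𝓝[≠] 0] fun x => |x| ^ (-r) := by
  obtain ⟨R, c, hR, -, hb⟩ := h 0
  refine IsBigO.of_bound c ?_
  have hsmall : ∀ᶠ x : ℝ in 𝓝[≠] 0, |x| < R⁻¹ := by
    refine eventually_nhdsWithin_of_eventually_nhds ?_
    have := Metric.ball_mem_nhds (0 : ℝ) (inv_pos.2 hR)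
    filter_upwards [this] with x hx
    simpa using hx
  filter_upwards [hsmall, self_mem_nhdsWithin] with x hx hx0
  have hpos : 0 < |x| := abs_pos.2 hx0
  have := hb x⁻¹ (by rw [abs_inv]; exact (lt_inv_comm₀ hpos hR).1 hx)
  rw [iteratedDeriv_zero, abs_inv, Nat.cast_zero, sub_zero, Real.inv_rpow hpos.le,
    ← Real.rpow_neg hpos.le] at this
  rwa [Real.norm_eq_abs, Real.norm_of_nonneg (Real.rpow_nonneg hpos.le _)]

theorem OrderAtMost.deriv {φ : ℝ → ℝ} {r : ℝ} (h : OrderAtMost φ r) :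
    OrderAtMost (deriv φ) (r - 1) := by
  intro k
  obtain ⟨R, c, hR, hc, hb⟩ := h (k + 1)
  refine ⟨R, c, hR, hc, fun x hx => ?_⟩
  have := hb x hx
  rw [iteratedDeriv_succ'] at this
  convert this using 3
  push_cast
  ring

/-- The function `x ↦ x ^ m * φ (1 / x)` on `ℝ ∖ {0}`, extended by `0` at the origin. -/
noncomputable def zpowMulCompInv (φ : ℝ → ℝ) (m : ℤ) (x : ℝ) : ℝ :=
  if x = 0 then 0 else x ^ m * φ x⁻¹

theorem zpowMulCompInv_zero (φ : ℝ → ℝ) (m : ℤ) : zpowMulCompInv φ m 0 = 0 := by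
  simp [zpowMulCompInv]

theorem zpowMulCompInv_of_ne_zero (φ : ℝ → ℝ) (m : ℤ) {x : ℝ} (hx : x ≠ 0) :
    zpowMulCompInv φ m x = x ^ m * φ x⁻¹ := by
  simp [zpowMulCompInv, hx]

open Filter Topology in
theorem zpowMulCompInv_eventuallyEq (φ : ℝ → ℝ) (m : ℤ) {x : ℝ} (hx : x ≠ 0) :
    zpowMulCompInv φ m =ᶠ[𝓝 x] fun y => y ^ m * φ y⁻¹ := by
  filter_upwards [isOpen_ne.mem_nhds hx] with y hy
  exact zpowMulCompInv_of_ne_zero φ m hy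

theorem hasDerivAt_zpow_mul_comp_inv {φ : ℝ → ℝ} (hφ : Differentiable ℝ φ) (m : ℤ) {x : ℝ}
    (hx : x ≠ 0) :
    HasDerivAt (fun y => y ^ m * φ y⁻¹)
      (m * (x ^ (m - 1) * φ x⁻¹) - x ^ (m - 2) * deriv φ x⁻¹) x := by
  have h1 := hasDerivAt_zpow m x (Or.inl hx)
  have h2 : HasDerivAt (fun y : ℝ => φ y⁻¹) (deriv φ x⁻¹ * (-(x ^ 2)⁻¹)) x :=
    (hφ x⁻¹).hasDerivAt.comp x (hasDerivAt_inv hx)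
  refine (h1.mul h2).congr_deriv ?_
  rw [zpow_sub₀ hx m 2]
  norm_cast
  ring

open Filter Topology Asymptotics in
theorem OrderAtMost.isBigO_zpowMulCompInv {φ : ℝ → ℝ} {r : ℝ} (h : OrderAtMost φ r) {m : ℤ}
    {k : ℕ} (hk : (k : ℝ) ≤ m - r) :
    zpowMulCompInv φ m =O[𝓝 0] fun x => ‖x - 0‖ ^ k := by
  have hpunct : zpowMulCompInv φ m =O[𝓝[≠] 0] fun x => ‖x - 0‖ ^ k := by
    have hprod := (isBigO_refl (fun x : ℝ => x ^ m) (𝓝[≠] 0)).mul h.isBigO_comp_inv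
    refine (hprod.congr' (f₂ := zpowMulCompInv φ m) (g₂ := fun x => x ^ m * |x| ^ (-r))
      ?_ EventuallyEq.rfl).trans ?_
    · filter_upwards [self_mem_nhdsWithin] with x hx
      exact (zpowMulCompInv_of_ne_zero φ m hx).symm
    · refine IsBigO.of_bound 1 ?_
      have hsmall : ∀ᶠ x : ℝ in 𝓝[≠] 0, |x| < 1 := by
        refine eventually_nhdsWithin_of_eventually_nhds ?_
        filter_upwards [Metric.ball_mem_nhds (0 : ℝ) one_pos] with x hx
        simpa using hx
      filter_upwards [hsmall, self_mem_nhdsWithin] with x hx hx0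
      have hpos : 0 < |x| := abs_pos.2 hx0
      rw [norm_mul, norm_zpow, sub_zero, norm_pow, norm_norm, Real.norm_eq_abs x,
        Real.norm_of_nonneg (Real.rpow_nonneg hpos.le _), ← Real.rpow_intCast,
        ← Real.rpow_add hpos, one_mul, ← Real.rpow_natCast]
      exact Real.rpow_le_rpow_of_exponent_ge hpos hx.le (by linarith)
  rw [← nhdsNE_sup_pure (0 : ℝ)]
  refine hpunct.sup (IsBigO.of_bound 1 ?_)
  simp [zpowMulCompInv_zero]

open Filter Topology in
theorem OrderAtMost.contDiff_zpowMulCompInv {k : ℕ} : ∀ {φ : ℝ → ℝ} {r : ℝ} {m : ℤ},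
    OrderAtMost φ r → ContDiff ℝ (⊤ : ℕ∞) φ → (k : ℝ) + 1 ≤ m - r →
      ContDiff ℝ k (zpowMulCompInv φ m) := by
  induction k with
  | zero =>
    intro φ r m h hφ hk
    rw [Nat.cast_zero, contDiff_zero, continuous_iff_continuousAt]
    intro x
    rcases eq_or_ne x 0 with rfl | hx
    · have hO := h.isBigO_zpowMulCompInv (m := m) (k := 1) (by simpa using hk)
      rw [ContinuousAt, zpowMulCompInv_zero]
      refine hO.trans_tendsto ?_
      have : Continuous fun x : ℝ => ‖x - 0‖ ^ 1 := by fun_prop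
      simpa using this.tendsto 0
    · exact ((hasDerivAt_zpow_mul_comp_inv (hφ.differentiable (by simp)) m hx).continuousAt).congr
        (zpowMulCompInv_eventuallyEq φ m hx).symm
  | succ k ih =>
    intro φ r m h hφ hk
    push_cast at hk
    have hφ' := contDiff_infty_iff_deriv.1 hφ
    have hderiv : ∀ x, HasDerivAt (zpowMulCompInv φ m)
        (m * zpowMulCompInv φ (m - 1) x - zpowMulCompInv (_root_.deriv φ) (m - 2) x) x := by
      intro x
      rcases eq_or_ne x 0 with rfl | hx
      · have hO := h.isBigO_zpowMulCompInv (m := m) (k := k + 2) (by push_cast; linarith)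
        simpa [zpowMulCompInv_zero] using (hO.hasFDerivAt (by lia)).hasDerivAt
      · rw [zpowMulCompInv_of_ne_zero _ _ hx, zpowMulCompInv_of_ne_zero _ _ hx]
        exact (hasDerivAt_zpow_mul_comp_inv hφ'.1 m hx).congr_of_eventuallyEq
          (zpowMulCompInv_eventuallyEq φ m hx)
    rw [Nat.cast_succ, contDiff_succ_iff_deriv]
    refine ⟨fun x => (hderiv x).differentiableAt, by simp, ?_⟩
    rw [funext fun x => (hderiv x).deriv]
    exact (contDiff_const.mul (ih h hφ (by push_cast; linarith))).sub
      (ih h.deriv hφ'.2 (by push_cast; linarith))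

theorem contDiffAt_pow_mul_comp_inv {φ : ℝ → ℝ} {N : WithTop ℕ∞} (hφ : ContDiff ℝ N φ) (n : ℕ)
    {x : ℝ} (hx : x ≠ 0) : ContDiffAt ℝ N (fun y => y ^ n * φ y⁻¹) x :=
  (contDiff_id.pow n).contDiffAt.mul (hφ.contDiffAt.comp x (contDiffAt_inv ℝ hx))

theorem iteratedDeriv_succ_id_mul {F : ℝ → ℝ} {n : ℕ} {x : ℝ}
    (hF : ContDiffAt ℝ (n + 1 : ℕ) F x) :
    iteratedDeriv (n + 1) (fun y => y * F y) x =
      x * iteratedDeriv (n + 1) F x + (n + 1) * iteratedDeriv n F x := by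
  rw [iteratedDeriv_fun_mul contDiffAt_fun_id hF, Finset.sum_range_succ', Finset.sum_range_succ']
  simp [iteratedDeriv_fun_id]
  ring

open Filter Topology in
theorem iteratedDeriv_succ_pow_mul_comp_inv {φ : ℝ → ℝ} (hφ : ContDiff ℝ (⊤ : ℕ∞) φ) (n : ℕ) :
    ∀ {x : ℝ}, x ≠ 0 → iteratedDeriv (n + 1) (fun y => y ^ n * φ y⁻¹) x =
      (-1) ^ (n + 1) * x ^ (-(n + 2 : ℤ)) * iteratedDeriv (n + 1) φ x⁻¹ := by
  induction n with
  | zero =>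
    intro x hx
    have := (hasDerivAt_zpow_mul_comp_inv (hφ.differentiable (by simp)) 0 hx).deriv
    simpa [iteratedDeriv_one] using this
  | succ n ih =>
    intro x hx
    have hev : iteratedDeriv (n + 1) (fun y => y ^ n * φ y⁻¹) =ᶠ[𝓝 x] fun y =>
        (-1) ^ (n + 1) * (y ^ (-(n + 2 : ℤ)) * iteratedDeriv (n + 1) φ y⁻¹) := by
      filter_upwards [isOpen_ne.mem_nhds hx] with y hy
      rw [ih hy, mul_assoc]
    have hdiff : Differentiable ℝ (iteratedDeriv (n + 1) φ) :=
      hφ.differentiable_iteratedDeriv (n + 1) (by exact_mod_cast WithTop.coe_lt_top _)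
    have hnext := ((hasDerivAt_zpow_mul_comp_inv hdiff (-(n + 2 : ℤ)) hx).const_mul
      ((-1) ^ (n + 1))).deriv
    rw [← hev.deriv_eq, ← iteratedDeriv_succ] at hnext
    have hpow : (fun y : ℝ => y ^ (n + 1) * φ y⁻¹) = fun y => y * (y ^ n * φ y⁻¹) := by
      funext y
      ring
    have hsmooth : ContDiffAt ℝ (n + 1 + 1 : ℕ) (fun y => y ^ n * φ y⁻¹) x :=
      contDiffAt_pow_mul_comp_inv (hφ.of_le (by exact_mod_cast le_top)) n hx
    rw [hpow, iteratedDeriv_succ_id_mul hsmooth, hnext, ih hx, ← iteratedDeriv_succ]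
    have e1 : x ^ (-(n + 2 : ℤ) - 1) = x ^ (-(n + 2 : ℤ)) * x⁻¹ := zpow_sub_one₀ hx _
    have e2 : x ^ (-(n + 2 : ℤ) - 2) = x ^ (-(n + 2 : ℤ)) * x⁻¹ * x⁻¹ := by
      rw [← e1, ← zpow_sub_one₀ hx]
      ring_nf
    have e3 : x ^ (-(((n + 1 : ℕ) : ℤ) + 2)) = x ^ (-(n + 2 : ℤ)) * x⁻¹ := by
      rw [← e1]
      congr 1
    rw [e1, e2, e3]
    push_cast
    field_simp
    ring

theorem gfun_eq_neg_zpowMulCompInv (f : ℝ → ℝ) (n : ℕ) :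
    gfun f n = -zpowMulCompInv (deriv f) ((n - 2 : ℕ) : ℤ) := by
  funext x
  by_cases hx : x = 0 <;> simp [gfun, zpowMulCompInv, hx]

/-- if `f'` is of order at most `−1` and `n ≥ 2`, then `g_n` is
`C^(n−2)` on `ℝ`, `C^∞` on `ℝ \ {0}`, and for `x ≠ 0` one has
`g_n^(n−1)(x) = (−1)^n x^(−n) f^(n)(1/x)`. -/
theorem statement1 (f : ℝ → ℝ) (hf : ContDiff ℝ (⊤ : ℕ∞) f)
    (hord : OrderAtMost (deriv f) (-1)) (n : ℕ) (hn : 2 ≤ n) :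
    ContDiff ℝ ((n - 2 : ℕ) : ℕ∞) (gfun f n) ∧
      ContDiffOn ℝ ((⊤ : ℕ∞) : WithTop ℕ∞) (gfun f n) {x : ℝ | x ≠ 0} ∧
      ∀ x : ℝ, x ≠ 0 →
        iteratedDeriv (n - 1) (gfun f n) x =
          (-1 : ℝ) ^ n * x ^ (-(n : ℤ)) * iteratedDeriv n f (1 / x) := by
  have hf' : ContDiff ℝ (⊤ : ℕ∞) (deriv f) := (contDiff_infty_iff_deriv.1 hf).2
  obtain ⟨k, rfl⟩ : ∃ k, n = k + 2 := ⟨n - 2, by lia⟩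
  have hev := fun {x : ℝ} (hx : x ≠ 0) =>
    zpowMulCompInv_eventuallyEq (deriv f) (k : ℤ) hx
  simp only [zpow_natCast] at hev
  rw [gfun_eq_neg_zpowMulCompInv, Nat.add_sub_cancel]
  refine ⟨?_, fun x hx => ?_, fun x hx => ?_⟩
  · exact (hord.contDiff_zpowMulCompInv hf' (by push_cast; linarith)).neg
  · exact ((contDiffAt_pow_mul_comp_inv hf' k hx).congr_of_eventuallyEq
      (hev hx)).neg.contDiffWithinAt
  · rw [show k + 2 - 1 = k + 1 by lia, iteratedDeriv_neg, (hev hx).iteratedDeriv_eq,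
      iteratedDeriv_succ_pow_mul_comp_inv hf' k hx, iteratedDeriv_succ' (n := k + 1), one_div]
    push_cast
    ring
end

section
/- Let f ∈ C^∞(ℝ) be such that f' is of order at most −1, let n ≥ 2, and define g_n : ℝ → ℝ by g_n(x) := −x^{n−2} f'(1/x) for x ≠ 0 and g_n(0) := 0. Then for all pairwise distinct nonzero real numbers x_1, …, x_n one has f'{x_1, …, x_n} = g_n[x_1^{−1}, …, x_n^{−1}], i.e. (−1)^n x_1 ⋯ x_n ∑_{j=1}^n f'(x_j)/∏_{k≠j}(x_j − x_k) = ∑_{j=1}^n g_n(x_j^{−1})/∏_{k≠j}(x_j^{−1} − x_k^{−1}). -/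
/-- for `f'` of order at most `−1`, `n ≥ 2`, and pairwise distinct
nonzero `x_1,…,x_n`, the weighted divided difference of `f'` equals the divided
difference of `g_n` at the reciprocals:
`(−1)^n x_1⋯x_n ∑_j f'(x_j)/∏_{k≠j}(x_j−x_k) = ∑_j g_n(x_j⁻¹)/∏_{k≠j}(x_j⁻¹−x_k⁻¹)`. -/
theorem statement5 (f : ℝ → ℝ) (hf : ContDiff ℝ (⊤ : ℕ∞) f)
    (hord : OrderAtMost (deriv f) (-1)) (n : ℕ) (hn : 2 ≤ n)
    (x : Fin n → ℝ) (hinj : Function.Injective x) (hx0 : ∀ j, x j ≠ 0) :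
    (-1 : ℝ) ^ n * (∏ j, x j) *
        ∑ j, deriv f (x j) / ∏ k ∈ Finset.univ.erase j, (x j - x k) =
      ∑ j, gfun f n (x j)⁻¹ / ∏ k ∈ Finset.univ.erase j, ((x j)⁻¹ - (x k)⁻¹) := by
  rw [Finset.mul_sum]
  refine Finset.sum_congr rfl fun j _ => ?_
  have hcard : (Finset.univ.erase j).card = n - 1 := by simp
  have hprod : ∏ k, x k = x j * ∏ k ∈ Finset.univ.erase j, x k :=
    (Finset.mul_prod_erase _ _ (Finset.mem_univ j)).symm
  have hden : ∏ k ∈ Finset.univ.erase j, ((x j)⁻¹ - (x k)⁻¹) =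
      (-1) ^ (n - 1) * (∏ k ∈ Finset.univ.erase j, (x j - x k)) /
        (x j ^ (n - 1) * ∏ k ∈ Finset.univ.erase j, x k) := by
    rw [← hcard, ← Finset.prod_const, ← Finset.prod_const, ← Finset.prod_mul_distrib,
      ← Finset.prod_mul_distrib, ← Finset.prod_div_distrib]
    refine Finset.prod_congr rfl fun k _ => ?_
    have := hx0 j
    have := hx0 k
    field_simp
    ring
  have hj := hx0 j
  have hP : ∏ k ∈ Finset.univ.erase j, x k ≠ 0 := Finset.prod_ne_zero_iff.2 fun k _ => hx0 k
  have hD : ∏ k ∈ Finset.univ.erase j, (x j - x k) ≠ 0 :=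
    Finset.prod_ne_zero_iff.2 fun k hk =>
      sub_ne_zero.2 (hinj.ne (Finset.ne_of_mem_erase hk).symm)
  rw [hden, hprod, gfun, if_neg (inv_ne_zero hj), one_div, inv_inv]
  obtain ⟨m, rfl⟩ := Nat.exists_eq_add_of_le' hn
  have hsign : ((-1 : ℝ) ^ m) * (-1) ^ m = 1 := by rw [← mul_pow]; norm_num
  simp only [Nat.add_sub_cancel, show m + 2 - 1 = m + 1 by omega, pow_succ, inv_pow]
  field_simp
  linear_combination deriv f (x j) * hsign
end

section
/- Let n ≥ 1, p ∈ ℝ_{≥0}, and let f ∈ C^∞(ℝ) be real-valued such that f' is of precise order −p−1. Then there exist numbers R, c_1, c_2 > 0 such that for all real numbers x_1, …, x_n satisfying R < x_1 ≤ ⋯ ≤ x_n, one has c_1 x_1^{−p} ≤ |f'{x_1, …, x_n}| ≤ c_2 x_1^{−p}. -/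
open MeasureTheory

/-- `f` is of precise order `r`: for every `k` there are `R, c₁, c₂ > 0` with
`c₁ |x|^(r-k) ≤ |f^(k)(x)| ≤ c₂ |x|^(r-k)` for all `|x| > R`. -/
def PreciseOrder (f : ℝ → ℝ) (r : ℝ) : Prop :=
  ∀ k : ℕ, ∃ R c₁ c₂ : ℝ, 0 < R ∧ 0 < c₁ ∧ 0 < c₂ ∧
    ∀ x : ℝ, R < |x| →
      c₁ * |x| ^ (r - (k : ℝ)) ≤ |iteratedDeriv k f x| ∧
        |iteratedDeriv k f x| ≤ c₂ * |x| ^ (r - (k : ℝ))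

theorem sum_succ_sub_castSucc {m : ℕ} (x : Fin (m + 1) → ℝ) :
    ∑ j : Fin m, (x j.succ - x j.castSucc) = x (Fin.last m) - x 0 := by
  induction m with
  | zero => simp
  | succ m ih =>
    rw [Fin.sum_univ_castSucc]
    have := ih (fun i => x i.castSucc)
    simp only [← Fin.succ_castSucc, Fin.castSucc_zero] at this ⊢
    rw [this]
    simp

/-- The point at which the integrand of `divDiff` is evaluated, rewritten in the
coordinates `1 - t j`. -/
theorem last_add_sum_eq {m : ℕ} (x : Fin (m + 1) → ℝ) (t : Fin m → ℝ) :
    x (Fin.last m) + ∑ j : Fin m, (x j.castSucc - x j.succ) * t j =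
      x 0 + ∑ j : Fin m, (x j.succ - x j.castSucc) * (1 - t j) := by
  have h := sum_succ_sub_castSucc x
  have : ∑ j : Fin m, (x j.succ - x j.castSucc) * (1 - t j) =
      ∑ j : Fin m, (x j.succ - x j.castSucc) +
        ∑ j : Fin m, (x j.castSucc - x j.succ) * t j := by
    rw [← Finset.sum_add_distrib]
    exact Finset.sum_congr rfl fun j _ => by ring
  rw [this, h]
  ring

theorem mul_sub_le_sum_of_antitone {m : ℕ} {x : Fin (m + 1) → ℝ} (hx : Monotone x)
    {s : Fin m → ℝ} (hs : Antitone s) (hs0 : ∀ j, 0 ≤ s j) (j : Fin m) :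
    s j * (x j.succ - x 0) ≤ ∑ i : Fin m, (x i.succ - x i.castSucc) * s i := by
  induction m with
  | zero => exact j.elim0
  | succ m ih =>
    have hd : ∀ i : Fin (m + 1), 0 ≤ x i.succ - x i.castSucc := fun i =>
      sub_nonneg.2 (hx i.castSucc_lt_succ.le)
    induction j using Fin.lastCases with
    | last =>
      have := sum_succ_sub_castSucc x
      rw [Fin.succ_last, ← this, Finset.mul_sum]
      refine Finset.sum_le_sum fun i _ => ?_
      rw [mul_comm]
      exact mul_le_mul_of_nonneg_left (hs (Fin.le_last i)) (hd i)
    | cast j =>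
      rw [Fin.sum_univ_castSucc]
      have h := ih (x := fun i => x i.castSucc) (fun a b hab => hx (by simpa using hab))
        (s := fun i => s i.castSucc) (fun a b hab => hs (by simpa using hab))
        (fun i => hs0 _) j
      have h2 := mul_nonneg (hd (Fin.last m)) (hs0 (Fin.last m))
      simp only [← Fin.succ_castSucc, Fin.castSucc_zero] at h ⊢
      linarith

/-- A continuous function without zeros on `(R, ∞)` has constant sign there. -/
theorem exists_sign_mul_eq_abs {g : ℝ → ℝ} (hg : Continuous g) {R : ℝ}
    (h : ∀ x, R < x → g x ≠ 0) :
    ∃ σ : ℝ, |σ| = 1 ∧ ∀ x, R < x → σ * g x = |g x| := by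
  by_cases hpos : ∀ x, R < x → 0 < g x
  · exact ⟨1, by simp, fun x hx => by rw [one_mul, abs_of_pos (hpos x hx)]⟩
  · push Not at hpos
    obtain ⟨a, ha, hga⟩ := hpos
    refine ⟨-1, by simp, fun x hx => ?_⟩
    have : g x ≤ 0 := by
      by_contra! hgx
      obtain ⟨y, hy, hy0⟩ := isPreconnected_Ioi.intermediate_value (Set.mem_Ioi.2 ha)
        (Set.mem_Ioi.2 hx) hg.continuousOn ⟨hga, hgx.le⟩
      exact h y hy hy0
    rw [abs_of_nonpos this, neg_one_mul]

theorem setIntegral_rpow_half_le {x₀ x δ : ℝ} (hx₀ : 0 < x₀) (hx : 0 < x) (hδ : 0 < δ) :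
    ∫ t in Set.Icc (0 : ℝ) 1, ((x₀ + (1 - t) * x) / 2) ^ (-(1 + δ)) ≤
      2 ^ (1 + δ) / δ * (x₀ ^ (-δ) / x) := by
  have hpos : ∀ t ∈ Set.uIcc (0 : ℝ) 1, 0 < x₀ + (1 - t) * x := by
    intro t ht
    rw [Set.uIcc_of_le zero_le_one] at ht
    have := mul_nonneg (sub_nonneg.2 ht.2) hx.le
    linarith
  rw [integral_Icc_eq_integral_Ioc, ← intervalIntegral.integral_of_le zero_le_one,
    intervalIntegral.integral_eq_sub_of_hasDerivAt
      (f := fun t => 2 ^ (1 + δ) / (δ * x) * (x₀ + (1 - t) * x) ^ (-δ))]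
  · have h0 := hpos 0 (by simp)
    have : 0 ≤ 2 ^ (1 + δ) / (δ * x) * (x₀ + (1 - 0) * x) ^ (-δ) := by positivity
    simp only [sub_self, zero_mul, add_zero]
    calc _ ≤ 2 ^ (1 + δ) / (δ * x) * x₀ ^ (-δ) := by linarith
      _ = _ := by field_simp
  · intro t ht
    have hlin : HasDerivAt (fun t : ℝ => x₀ + (1 - t) * x) (-x) t := by
      simpa using (((hasDerivAt_id t).const_sub 1).mul_const x).const_add x₀
    refine ((hlin.rpow_const (p := -δ) (Or.inl (hpos t ht).ne')).const_mul
      (2 ^ (1 + δ) / (δ * x))).congr_deriv ?_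
    rw [Real.div_rpow (hpos t ht).le zero_le_two, Real.rpow_neg zero_le_two,
      show -δ - 1 = -(1 + δ) by ring]
    field_simp
  · refine ContinuousOn.intervalIntegrable ?_
    refine ContinuousOn.rpow_const (by fun_prop) fun t ht => Or.inl ?_
    exact (half_pos (hpos t ht)).ne'

theorem isCompact_setOf_monotone_mem_Icc (m : ℕ) :
    IsCompact {t : Fin m → ℝ | Monotone t ∧ ∀ j, t j ∈ Set.Icc (0 : ℝ) 1} := by
  have h : {t : Fin m → ℝ | Monotone t ∧ ∀ j, t j ∈ Set.Icc (0 : ℝ) 1} =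
      {t | Monotone t} ∩ Set.univ.pi fun _ => Set.Icc (0 : ℝ) 1 := by
    ext t
    simp [Pi.le_def, forall_and]
  rw [h]
  exact (isCompact_univ_pi fun _ => isCompact_Icc).inter_left isClosed_monotone

theorem rpow_neg_le_prod {m : ℕ} {p : ℝ} (hp : 0 ≤ p) {ξ x₀ : ℝ} (hx₀ : 0 < x₀)
    (hξ : x₀ ≤ ξ) {y : Fin m → ℝ} (hy : ∀ j, 0 < y j) (hyξ : ∀ j, y j ≤ ξ) :
    ξ ^ (-p - 1 - (m : ℝ)) ≤ x₀ ^ (-p - 1 / ((m : ℝ) + 1)) *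
      ∏ j, y j ^ (-(1 + 1 / ((m : ℝ) + 1))) := by
  have hξ0 : 0 < ξ := hx₀.trans_le hξ
  have hδ : 0 < 1 / ((m : ℝ) + 1) := by positivity
  have hprod : ξ ^ (-p - 1 - (m : ℝ)) = ξ ^ (-p - 1 / ((m : ℝ) + 1)) *
      ∏ _j : Fin m, ξ ^ (-(1 + 1 / ((m : ℝ) + 1))) := by
    rw [Finset.prod_const, Finset.card_univ, Fintype.card_fin, ← Real.rpow_natCast,
      ← Real.rpow_mul hξ0.le, ← Real.rpow_add hξ0]
    congr 1
    field_simp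
    ring
  rw [hprod]
  refine mul_le_mul ?_ ?_ (Finset.prod_nonneg fun j _ => Real.rpow_nonneg hξ0.le _)
    (Real.rpow_nonneg hx₀.le _)
  · exact Real.rpow_le_rpow_of_nonpos hx₀ hξ (by linarith)
  · exact Finset.prod_le_prod (fun j _ => Real.rpow_nonneg hξ0.le _) fun j _ =>
      Real.rpow_le_rpow_of_nonpos (hy j) (hyξ j) (by linarith)

section Bounds

variable {m : ℕ} {x : Fin (m + 1) → ℝ}

theorem le_last_add_sum (hx : Monotone x) {t : Fin m → ℝ}
    (ht : ∀ j, t j ∈ Set.Icc (0 : ℝ) 1) :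
    x 0 ≤ x (Fin.last m) + ∑ j : Fin m, (x j.castSucc - x j.succ) * t j := by
  rw [last_add_sum_eq, le_add_iff_nonneg_right]
  exact Finset.sum_nonneg fun i _ => mul_nonneg
    (sub_nonneg.2 (hx i.castSucc_lt_succ.le)) (sub_nonneg.2 (ht i).2)

theorem half_le_last_add_sum (hx : Monotone x) (h0 : 0 < x 0) {t : Fin m → ℝ}
    (htm : Monotone t) (ht : ∀ j, t j ∈ Set.Icc (0 : ℝ) 1) (j : Fin m) :
    (x 0 + (1 - t j) * x j.succ) / 2 ≤
      x (Fin.last m) + ∑ j : Fin m, (x j.castSucc - x j.succ) * t j := by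
  have h1 := le_last_add_sum hx ht
  rw [last_add_sum_eq] at h1 ⊢
  have h2 := mul_sub_le_sum_of_antitone hx (s := fun i => 1 - t i)
    (fun a b hab => sub_le_sub_left (htm hab) 1) (fun i => sub_nonneg.2 (ht i).2) j
  have h3 := mul_nonneg (ht j).1 h0.le
  linarith

theorem setIntegral_rpow_le {p : ℝ} (hp : 0 ≤ p) (hx : Monotone x) (h0 : 0 < x 0)
    {G : ℝ → ℝ} (hG : Continuous G) {c : ℝ} (hc : 0 ≤ c)
    (hGc : ∀ y, x 0 ≤ y → G y ≤ c * y ^ (-p - 1 - (m : ℝ))) :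
    (∏ j, x j) * ∫ t in {t : Fin m → ℝ | Monotone t ∧ ∀ j, t j ∈ Set.Icc (0 : ℝ) 1},
      G (x (Fin.last m) + ∑ j : Fin m, (x j.castSucc - x j.succ) * t j) ≤
    c * (2 ^ (1 + 1 / ((m : ℝ) + 1)) / (1 / ((m : ℝ) + 1))) ^ m * x 0 ^ (-p) := by
  have hxp : ∀ j, 0 < x j := fun j => h0.trans_le (hx (Fin.zero_le j))
  set δ : ℝ := 1 / ((m : ℝ) + 1) with hδ
  have hδ0 : 0 < δ := by positivity
  set S := {t : Fin m → ℝ | Monotone t ∧ ∀ j, t j ∈ Set.Icc (0 : ℝ) 1} with hS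
  have hSc : IsCompact S := isCompact_setOf_monotone_mem_Icc m
  let h : Fin m → ℝ → ℝ := fun j => (Set.Icc (0 : ℝ) 1).indicator
    fun t => ((x 0 + (1 - t) * x j.succ) / 2) ^ (-(1 + δ))
  have hbase : ∀ (j : Fin m), ∀ t ∈ Set.Icc (0 : ℝ) 1,
      0 < (x 0 + (1 - t) * x j.succ) / 2 := by
    intro j t ht
    have := mul_nonneg (sub_nonneg.2 ht.2) (hxp j.succ).le
    linarith
  have hhInt : ∀ j, Integrable (h j) := by
    intro j
    refine (integrable_indicator_iff measurableSet_Icc).2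
      (ContinuousOn.integrableOn_Icc ?_)
    exact ContinuousOn.rpow_const (by fun_prop) fun t ht => Or.inl (hbase j t ht).ne'
  have hnn : ∀ j t, 0 ≤ h j t := fun j t =>
    Set.indicator_nonneg (fun t ht => Real.rpow_nonneg (hbase j t ht).le _) t
  have hHint : Integrable fun t : Fin m → ℝ => ∏ j, h j (t j) :=
    Integrable.fintype_prod hhInt
  have hA : 0 ≤ c * x 0 ^ (-p - δ) := mul_nonneg hc (Real.rpow_nonneg h0.le _)
  have key : ∫ t in S, G (x (Fin.last m) + ∑ j : Fin m, (x j.castSucc - x j.succ) * t j) ≤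
      c * x 0 ^ (-p - δ) * ∏ j : Fin m, (2 ^ (1 + δ) / δ * (x 0 ^ (-δ) / x j.succ)) := by
    calc _ ≤ ∫ t in S, c * x 0 ^ (-p - δ) * ∏ j, h j (t j) := by
          refine setIntegral_mono_on
            ((Continuous.continuousOn (by fun_prop)).integrableOn_compact hSc)
            (hHint.const_mul _).integrableOn hSc.measurableSet fun t ht => ?_
          have h1 := le_last_add_sum hx ht.2
          refine (hGc _ h1).trans ?_
          rw [mul_assoc]
          refine mul_le_mul_of_nonneg_left ?_ hc
          refine (rpow_neg_le_prod hp h0 h1 (fun j => hbase j _ (ht.2 j))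
            (half_le_last_add_sum hx h0 ht.1 ht.2)).trans_eq ?_
          congr 1
          exact Finset.prod_congr rfl fun j _ => by simp only [h, Set.indicator_of_mem (ht.2 j), hδ]
      _ ≤ ∫ t : Fin m → ℝ, c * x 0 ^ (-p - δ) * ∏ j, h j (t j) :=
          setIntegral_le_integral (hHint.const_mul _) (Filter.Eventually.of_forall fun t =>
            mul_nonneg hA (Finset.prod_nonneg fun j _ => hnn j _))
      _ = c * x 0 ^ (-p - δ) * ∏ j, ∫ t, h j t := by
          rw [integral_const_mul, integral_fintype_prod_volume_eq_prod]
      _ ≤ _ := by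
          refine mul_le_mul_of_nonneg_left (Finset.prod_le_prod
            (fun j _ => integral_nonneg (hnn j)) fun j _ => ?_) hA
          rw [integral_indicator measurableSet_Icc]
          exact setIntegral_rpow_half_le h0 (hxp _) hδ0
  refine (mul_le_mul_of_nonneg_left key (Finset.prod_nonneg fun j _ => (hxp j).le)).trans_eq ?_
  have hne : ∏ j : Fin m, x j.succ ≠ 0 := Finset.prod_ne_zero_iff.2 fun j _ => (hxp _).ne'
  rw [Fin.prod_univ_succ, Finset.prod_mul_distrib, Finset.prod_const,
    Finset.prod_div_distrib (f := fun _ => x 0 ^ (-δ)), Finset.prod_const, Finset.card_univ,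
    Fintype.card_fin]
  have hpow : x 0 * x 0 ^ (-p - δ) * (x 0 ^ (-δ)) ^ m = x 0 ^ (-p) := by
    rw [← Real.rpow_natCast, ← Real.rpow_mul h0.le]
    nth_rewrite 1 [← Real.rpow_one (x 0)]
    rw [← Real.rpow_add h0, ← Real.rpow_add h0]
    congr 1
    rw [hδ]
    field_simp
    ring
  rw [← hpow]
  field_simp

theorem le_setIntegral_rpow {p : ℝ} (hp : 0 ≤ p) (hx : Monotone x) (h0 : 0 < x 0)
    {G : ℝ → ℝ} (hG : Continuous G) {c : ℝ} (hc : 0 ≤ c)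
    (hGc : ∀ y, x 0 ≤ y → c * y ^ (-p - 1 - (m : ℝ)) ≤ G y) :
    c * ((m : ℝ) + 1) ^ (-p - 1 - (m : ℝ)) * (∏ j : Fin m, (1 / 2 : ℝ) ^ ((j : ℕ) + 1)) *
      x 0 ^ (-p) ≤
    (∏ j, x j) * ∫ t in {t : Fin m → ℝ | Monotone t ∧ ∀ j, t j ∈ Set.Icc (0 : ℝ) 1},
      G (x (Fin.last m) + ∑ j : Fin m, (x j.castSucc - x j.succ) * t j) := by
  have hxp : ∀ j, 0 < x j := fun j => h0.trans_le (hx (Fin.zero_le j))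
  set S := {t : Fin m → ℝ | Monotone t ∧ ∀ j, t j ∈ Set.Icc (0 : ℝ) 1} with hS
  have hSc : IsCompact S := isCompact_setOf_monotone_mem_Icc m
  let a : Fin m → ℝ := fun j => 1 - (1 / 2 : ℝ) ^ (j : ℕ) * (x 0 / x j.succ)
  let b : Fin m → ℝ := fun j => 1 - (1 / 2 : ℝ) ^ ((j : ℕ) + 1) * (x 0 / x j.succ)
  have hr0 : ∀ j : Fin m, 0 < x 0 / x j.succ := fun j => div_pos h0 (hxp _)
  have hr1 : ∀ j : Fin m, x 0 / x j.succ ≤ 1 := fun j =>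
    (div_le_one (hxp _)).2 (hx (Fin.zero_le _))
  have hpow1 : ∀ k : ℕ, (1 / 2 : ℝ) ^ k ≤ 1 := fun k =>
    pow_le_one₀ (by norm_num) (by norm_num)
  have hba : ∀ j, b j - a j = (1 / 2 : ℝ) ^ ((j : ℕ) + 1) * (x 0 / x j.succ) := by
    intro j
    simp only [a, b, pow_succ]
    ring
  have hab : ∀ j, a j ≤ b j := fun j => sub_nonneg.1 (by
    rw [hba]; exact mul_nonneg (by positivity) (hr0 j).le)
  have hmono : ∀ i j : Fin m, i < j → b i ≤ a j := by
    intro i j hij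
    refine sub_le_sub_left (mul_le_mul ?_ ?_ (hr0 j).le (by positivity)) 1
    · exact pow_le_pow_of_le_one (by norm_num) (by norm_num) hij
    · exact div_le_div_of_nonneg_left h0.le (hxp _) (hx (Fin.succ_le_succ_iff.2 hij.le))
  have hsub : Set.Icc a b ⊆ S := by
    intro t ht
    refine ⟨fun i j hij => ?_, fun j => ⟨?_, ?_⟩⟩
    · rcases hij.eq_or_lt with rfl | hij
      · rfl
      · exact (ht.2 i).trans ((hmono i j hij).trans (ht.1 j))
    · refine le_trans (sub_nonneg.2 ?_) (ht.1 j)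
      exact mul_le_one₀ (hpow1 _) (hr0 j).le (hr1 j)
    · refine (ht.2 j).trans (sub_le_self _ ?_)
      exact mul_nonneg (by positivity) (hr0 j).le
  have hupper : ∀ t ∈ Set.Icc a b,
      x (Fin.last m) + ∑ j : Fin m, (x j.castSucc - x j.succ) * t j ≤ ((m : ℝ) + 1) * x 0 := by
    intro t ht
    rw [last_add_sum_eq]
    have : ∑ j : Fin m, (x j.succ - x j.castSucc) * (1 - t j) ≤ ∑ _j : Fin m, x 0 := by
      refine Finset.sum_le_sum fun j _ => ?_
      have h1 : 0 ≤ 1 - t j := sub_nonneg.2 ((hsub ht).2 j).2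
      have h2 : 1 - t j ≤ x 0 / x j.succ := by
        have h3 := ht.1 j
        have h4 := mul_le_of_le_one_left (hr0 j).le (hpow1 j)
        simp only [a] at h3
        linarith
      calc _ ≤ x j.succ * (1 - t j) :=
            mul_le_mul_of_nonneg_right (sub_le_self _ (hxp _).le) h1
        _ ≤ x j.succ * (x 0 / x j.succ) := mul_le_mul_of_nonneg_left h2 (hxp _).le
        _ = x 0 := mul_div_cancel₀ _ (hxp _).ne'
    rw [Finset.sum_const, Finset.card_univ, Fintype.card_fin, nsmul_eq_mul] at this
    linarith
  have hGint : IntegrableOn (fun t : Fin m → ℝ =>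
      G (x (Fin.last m) + ∑ j : Fin m, (x j.castSucc - x j.succ) * t j)) S :=
    (Continuous.continuousOn (by fun_prop)).integrableOn_compact hSc
  have key : c * (((m : ℝ) + 1) * x 0) ^ (-p - 1 - (m : ℝ)) *
      ∏ j : Fin m, ((1 / 2 : ℝ) ^ ((j : ℕ) + 1) * (x 0 / x j.succ)) ≤
      ∫ t in S, G (x (Fin.last m) + ∑ j : Fin m, (x j.castSucc - x j.succ) * t j) := by
    calc _ = ∫ _t in Set.Icc a b, c * (((m : ℝ) + 1) * x 0) ^ (-p - 1 - (m : ℝ)) := by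
          rw [setIntegral_const, smul_eq_mul, mul_comm, Measure.real,
            Real.volume_Icc_pi_toReal hab]
          simp_rw [hba]
      _ ≤ ∫ t in Set.Icc a b,
            G (x (Fin.last m) + ∑ j : Fin m, (x j.castSucc - x j.succ) * t j) := by
          refine setIntegral_mono_on (integrableOn_const (isCompact_Icc.measure_lt_top.ne))
            (hGint.mono_set hsub) measurableSet_Icc fun t ht => ?_
          have h1 := le_last_add_sum hx (hsub ht).2
          refine le_trans (mul_le_mul_of_nonneg_left ?_ hc) (hGc _ h1)
          have hm : (0 : ℝ) ≤ m := m.cast_nonneg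
          exact Real.rpow_le_rpow_of_nonpos (h0.trans_le h1) (hupper t ht) (by linarith)
      _ ≤ _ := by
          refine setIntegral_mono_set hGint ?_ hsub.eventuallyLE
          filter_upwards [ae_restrict_mem hSc.measurableSet] with t ht
          have h1 := le_last_add_sum hx ht.2
          exact (mul_nonneg hc (Real.rpow_nonneg (h0.le.trans h1) _)).trans (hGc _ h1)
  refine le_trans (le_of_eq ?_)
    (mul_le_mul_of_nonneg_left key (Finset.prod_nonneg fun j _ => (hxp j).le))
  have hne : ∏ j : Fin m, x j.succ ≠ 0 := Finset.prod_ne_zero_iff.2 fun j _ => (hxp _).ne'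
  rw [Fin.prod_univ_succ, Finset.prod_mul_distrib, Finset.prod_div_distrib,
    Finset.prod_const, Finset.card_univ, Fintype.card_fin,
    Real.mul_rpow (by positivity) h0.le]
  have hpow : x 0 * x 0 ^ (-p - 1 - (m : ℝ)) * x 0 ^ m = x 0 ^ (-p) := by
    rw [← Real.rpow_natCast]
    nth_rewrite 1 [← Real.rpow_one (x 0)]
    rw [← Real.rpow_add h0, ← Real.rpow_add h0]
    congr 1
    ring
  rw [← hpow]
  field_simp

end Bounds

/-- for `n ≥ 1`, `p ≥ 0` and `f'` of precise order `−p−1`, there are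
`R, c₁, c₂ > 0` such that for all `R < x_1 ≤ ⋯ ≤ x_n` one has
`c₁ x_1^(−p) ≤ |f'{x_1,…,x_n}| ≤ c₂ x_1^(−p)`. -/
theorem statement6 (n : ℕ) (hn : 1 ≤ n) (p : ℝ) (hp : 0 ≤ p)
    (f : ℝ → ℝ) (hf : ContDiff ℝ (⊤ : ℕ∞) f)
    (hord : PreciseOrder (deriv f) (-p - 1)) :
    ∃ R c₁ c₂ : ℝ, 0 < R ∧ 0 < c₁ ∧ 0 < c₂ ∧
      ∀ x : Fin n → ℝ, R < x ⟨0, hn⟩ → Monotone x →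
        c₁ * x ⟨0, hn⟩ ^ (-p) ≤ |wDivDiff f x| ∧
          |wDivDiff f x| ≤ c₂ * x ⟨0, hn⟩ ^ (-p) := by
  obtain ⟨m, rfl⟩ := Nat.exists_eq_add_of_le' hn
  obtain ⟨R, c₁, c₂, hR, hc₁, hc₂, hb⟩ := hord m
  have hcont : Continuous (iteratedDeriv m (deriv f)) := by
    have := (contDiff_infty_iff_deriv.1 hf).2
    exact this.continuous_iteratedDeriv m (by exact_mod_cast le_top)
  have hpos : ∀ y, R < y → 0 < y ∧ R < |y| ∧ |y| = y := fun y hy =>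
    have h := hR.trans hy
    ⟨h, by rwa [abs_of_pos h], abs_of_pos h⟩
  obtain ⟨σ, hσ, hσg⟩ := exists_sign_mul_eq_abs hcont (R := R) (fun y hy h0 => by
    obtain ⟨h1, h2, h3⟩ := hpos y hy
    have := (hb y h2).1
    rw [h0, abs_zero, h3] at this
    exact absurd this (not_le.2 (mul_pos hc₁ (Real.rpow_pos_of_pos h1 _))))
  refine ⟨R, c₁ * ((m : ℝ) + 1) ^ (-p - 1 - (m : ℝ)) *
      (∏ j : Fin m, (1 / 2 : ℝ) ^ ((j : ℕ) + 1)),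
    c₂ * (2 ^ (1 + 1 / ((m : ℝ) + 1)) / (1 / ((m : ℝ) + 1))) ^ m, hR, by positivity,
    by positivity, fun x hx0 hx => ?_⟩
  change R < x 0 at hx0
  change _ * x 0 ^ (-p) ≤ _ ∧ _ ≤ _ * x 0 ^ (-p)
  have h0 : 0 < x 0 := hR.trans hx0
  have hprod : 0 ≤ ∏ j, x j :=
    Finset.prod_nonneg fun j _ => (h0.trans_le (hx (Fin.zero_le j))).le
  have habs : |wDivDiff f x| = (∏ j, x j) * |divDiff (deriv f) x| := by
    simp [wDivDiff, abs_mul, abs_of_nonneg hprod]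
  have hG : Continuous fun y => |iteratedDeriv m (deriv f) y| := hcont.abs
  have hdiv : |divDiff (deriv f) x| =
      ∫ t in {t : Fin m → ℝ | Monotone t ∧ ∀ j, t j ∈ Set.Icc (0 : ℝ) 1},
        |iteratedDeriv m (deriv f)
          (x (Fin.last m) + ∑ j : Fin m, (x j.castSucc - x j.succ) * t j)| := by
    have hmul : |divDiff (deriv f) x| = |σ * divDiff (deriv f) x| := by
      rw [abs_mul, hσ, one_mul]
    rw [hmul, divDiff, ← integral_const_mul,
      setIntegral_congr_fun (isCompact_setOf_monotone_mem_Icc m).measurableSet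
        (fun t ht => hσg _ (hx0.trans_le (le_last_add_sum hx ht.2)))]
    exact abs_of_nonneg (integral_nonneg fun t => abs_nonneg _)
  rw [habs, hdiv]
  constructor
  · refine le_setIntegral_rpow hp hx h0 hG hc₁.le fun y hy => ?_
    obtain ⟨-, h2, h3⟩ := hpos y (hx0.trans_le hy)
    simpa only [h3] using (hb y h2).1
  · refine setIntegral_rpow_le hp hx h0 hG hc₂.le fun y hy => ?_
    obtain ⟨-, h2, h3⟩ := hpos y (hx0.trans_le hy)
    simpa only [h3] using (hb y h2).2
end
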